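/- Let p ≥ 1 and let f be a nonnegative measurable function of a random variable X such that E f(X)^p < ∞ and the distribution of f(X) is atomless. Let 0 ≤ λ < 1, C ≥ 1, 0 < Δ < 1, and let x_1,…,x_N satisfy Properties (1)–(3) for f with constants λ, C, Δ. Let θ satisfy 4Δ·max{1+λ, C+3/2} ≤ θ < 1, and set θ₂ = (θ − 2CΔ)/(1+λ). Then (1/N)·Σ_{j ≥ θN} (f(x_i)^p)_j^* ≤ E f(X)^p + 2√Δ·∫_0^{Q_{1−θ₂}(f)} p·t^{p−1}·√(P(f > t)) dt, where the trimmed mean on the left is the sum of the values f(x_i)^p after discarding the ⌈θN⌉ largest ones, divided by N. -/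

import Mathlib

open MeasureTheory Real

/-- The trimmed mean: discard the `⌈θN⌉` largest values of `z` and average the rest. -/
noncomputable def trimmedMean {N : ℕ} (z : Fin N → ℝ) (θ : ℝ) : ℝ :=
  (N : ℝ)⁻¹ * ∑ j ∈ Finset.univ.filter
      (fun j : Fin N => (j : ℕ) < N - Nat.ceil (θ * N)), z (Tuple.sort z j)

/-- Empirical measure of a set along the sample `x`. -/
noncomputable def empP {Ω : Type*} {N : ℕ} (x : Fin N → Ω) (s : Set Ω) : ℝ :=
  (N : ℝ)⁻¹ * ∑ i : Fin N, s.indicator (fun _ => (1 : ℝ)) (x i)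

/-- Properties (1)-(3) of the sample `x` for the function `f`, with constants `lam`, `C`, `Δ`. -/
def SatisfiesProps {Ω : Type*} [MeasurableSpace Ω] (μ : Measure Ω) (f : Ω → ℝ)
    {N : ℕ} (x : Fin N → Ω) (lam C Δ : ℝ) : Prop :=
  (∀ t : ℝ, 0 < t → Δ ≤ (μ {ω | t < f ω}).toReal →
    |empP x {ω | t < f ω} / (μ {ω | t < f ω}).toReal - 1| ≤ lam) ∧
  (∀ (j : ℕ) (t : ℝ), 0 < t → Δ ≤ 2 ^ (-(j : ℝ)) * (μ {ω | t < f ω}).toReal →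
    |empP x {ω | t < f ω} / (μ {ω | t < f ω}).toReal - 1| ≤ 2 ^ (-(j : ℝ) / 2)) ∧
  (∀ I : Set ℝ, I.OrdConnected →
    empP x {ω | f ω ∈ I} ≤ 3 / 2 * (μ {ω | f ω ∈ I}).toReal + C * Δ)

/-- `Q_{1-η}(f) = inf {t : P(f > t) < η}`. -/
noncomputable def quant {Ω : Type*} [MeasurableSpace Ω] (μ : Measure Ω) (f : Ω → ℝ)
    (η : ℝ) : ℝ :=
  sInf {t : ℝ | (μ {ω | t < f ω}).toReal < η}

/-- `E_{T,p}(f) = 2√Δ ∫_0^T p t^{p-1} √(P(f>t)) dt`. -/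
noncomputable def errE {Ω : Type*} [MeasurableSpace Ω] (μ : Measure Ω) (f : Ω → ℝ)
    (Δ p T : ℝ) : ℝ :=
  2 * Real.sqrt Δ * ∫ t in (0 : ℝ)..T, p * t ^ (p - 1) * Real.sqrt ((μ {ω | t < f ω}).toReal)

section TrimmedMean

lemma empP_eq_card {Ω : Type*} {f : Ω → ℝ} {N : ℕ} (x : Fin N → Ω) (t : ℝ) :
    empP x {ω | t < f ω} =
      (N : ℝ)⁻¹ * (Finset.univ.filter fun i => t < f (x i)).card := by
  simp [empP, Set.indicator_apply, Finset.sum_boole]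

variable {Ω : Type*} [MeasurableSpace Ω] {μ : Measure Ω} {f : Ω → ℝ}

lemma antitone_tail [IsProbabilityMeasure μ] :
    Antitone fun t : ℝ => (μ {ω | t < f ω}).toReal := by
  intro s t hst
  exact ENNReal.toReal_mono (measure_ne_top _ _)
    (measure_mono fun ω (h : t < f ω) => lt_of_le_of_lt hst h)

lemma zero_mem_lowerBounds_tail_lt [IsProbabilityMeasure μ] (hnonneg : ∀ ω, 0 ≤ f ω) {η : ℝ} (hη : η < 1) :
    0 ∈ lowerBounds {t : ℝ | (μ {ω | t < f ω}).toReal < η} := by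
  intro t ht
  by_contra! hlt
  have huniv : {ω | t < f ω} = Set.univ :=
    Set.eq_univ_of_forall fun ω => lt_of_lt_of_le hlt (hnonneg ω)
  simp only [Set.mem_ofPred_eq, huniv, measure_univ, ENNReal.toReal_one] at ht
  linarith

lemma le_tail_of_lt_quant [IsProbabilityMeasure μ] (hnonneg : ∀ ω, 0 ≤ f ω) {η t : ℝ}
    (hη : η < 1) (ht : t < quant μ f η) : η ≤ (μ {ω | t < f ω}).toReal := by
  by_contra! h
  exact absurd (csInf_le ⟨0, zero_mem_lowerBounds_tail_lt hnonneg hη⟩ h) (not_le.mpr ht)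

lemma continuous_tail [IsProbabilityMeasure μ] (hmeas : Measurable f)
    (hatomless : ∀ t : ℝ, μ {ω | f ω = t} = 0) :
    Continuous fun t : ℝ => (μ {ω | t < f ω}).toReal := by
  have key : (fun t : ℝ => (μ {ω | t < f ω}).toReal) =
      fun t => ∫ ω, (if t < f ω then (1 : ℝ) else 0) ∂μ := by
    funext t
    have hs : MeasurableSet {ω | t < f ω} := measurableSet_lt measurable_const hmeas
    have := integral_indicator_one (μ := μ) hs
    rw [Measure.real] at this
    rw [← this]
    refine integral_congr_ae (Filter.Eventually.of_forall fun ω => ?_)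
    simp [Set.indicator_apply]
  rw [key, continuous_iff_continuousAt]
  intro t
  refine continuousAt_of_dominated (bound := fun _ => 1) ?_ ?_ (integrable_const _) ?_
  · refine Filter.Eventually.of_forall fun s => ?_
    exact (Measurable.ite (measurableSet_lt measurable_const hmeas) measurable_const
      measurable_const).aestronglyMeasurable
  · refine Filter.Eventually.of_forall fun s => Filter.Eventually.of_forall fun ω => ?_
    split_ifs <;> simp
  · have hne : ∀ᵐ ω ∂μ, f ω ≠ t := by
      rw [ae_iff]
      simpa using hatomless t
    filter_upwards [hne] with ω hω
    rcases lt_or_gt_of_ne hω with h | h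
    · refine continuousAt_const.congr (f := fun _ => (0 : ℝ)) ?_
      filter_upwards [lt_mem_nhds h] with s hs
      simp [not_lt.mpr hs.le]
    · refine continuousAt_const.congr (f := fun _ => (1 : ℝ)) ?_
      filter_upwards [gt_mem_nhds h] with s hs
      simp [hs]

lemma tendsto_tail_atTop [IsProbabilityMeasure μ] (hmeas : Measurable f) :
    Filter.Tendsto (fun t : ℝ => (μ {ω | t < f ω}).toReal) Filter.atTop (nhds 0) := by
  have h := tendsto_measure_iInter_atTop (μ := μ) (s := fun t : ℝ => {ω | t < f ω})
    (fun t => (measurableSet_lt measurable_const hmeas).nullMeasurableSet)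
    (fun s t hst ω (hω : t < f ω) => lt_of_le_of_lt hst hω) ⟨0, measure_ne_top _ _⟩
  have hempty : (⋂ t : ℝ, {ω | t < f ω}) = ∅ := by
    ext ω
    simp only [Set.mem_iInter, Set.mem_ofPred_eq, Set.mem_empty_iff_false, iff_false, not_forall]
    exact ⟨f ω, lt_irrefl _⟩
  rw [hempty, measure_empty] at h
  simpa [Function.comp_def] using (ENNReal.tendsto_toReal ENNReal.zero_ne_top).comp h

lemma tail_quant [IsProbabilityMeasure μ] (hmeas : Measurable f) (hnonneg : ∀ ω, 0 ≤ f ω)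
    (hatomless : ∀ t : ℝ, μ {ω | f ω = t} = 0) {η : ℝ} (hη0 : 0 < η) (hη1 : η < 1) :
    0 < quant μ f η ∧ (μ {ω | quant μ f η < f ω}).toReal = η := by
  have hcont := continuous_tail hmeas hatomless
  have hne : {t : ℝ | (μ {ω | t < f ω}).toReal < η}.Nonempty :=
    ((tendsto_tail_atTop hmeas).eventually (gt_mem_nhds hη0)).exists
  have hT : (μ {ω | quant μ f η < f ω}).toReal = η := by
    refine le_antisymm ?_ ?_
    · have hmem := csInf_mem_closure hne ⟨0, zero_mem_lowerBounds_tail_lt hnonneg hη1⟩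
      exact (closure_minimal (fun t (ht : _ < η) => ht.le)
        (isClosed_le hcont continuous_const)) hmem
    · have hmem : quant μ f η ∈ closure (Set.Iio (quant μ f η)) := by simp
      exact (closure_minimal (fun t ht => le_tail_of_lt_quant hnonneg hη1 ht)
        (isClosed_le continuous_const hcont)) hmem
  refine ⟨lt_of_le_of_ne (le_csInf hne (zero_mem_lowerBounds_tail_lt hnonneg hη1)) fun h0 => ?_, hT⟩
  rw [← h0] at hT
  have hone : μ {ω | 0 < f ω} = 1 := by
    rw [← prob_compl_eq_zero_iff (measurableSet_lt measurable_const hmeas)]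
    refine measure_mono_null (fun ω hω => ?_) (hatomless 0)
    exact le_antisymm (not_lt.mp hω) (hnonneg ω)
  rw [hone, ENNReal.toReal_one] at hT
  linarith

lemma empP_le_of_abs_sub_le {F FN s : ℝ} (hF : 0 < F) (h : |FN / F - 1| ≤ s) :
    FN ≤ F * (1 + s) := by
  have h2 : FN / F ≤ 1 + s := by linarith [(abs_le.mp h).2]
  rw [div_le_iff₀ hF] at h2
  linarith

lemma SatisfiesProps.empP_le {N : ℕ} {x : Fin N → Ω} {lam C Δ : ℝ}
    (hprops : SatisfiesProps μ f x lam C Δ) (hΔ : 0 < Δ) {t : ℝ} (ht : 0 < t)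
    (hF : Δ ≤ (μ {ω | t < f ω}).toReal) :
    empP x {ω | t < f ω} ≤
      (μ {ω | t < f ω}).toReal + 2 * √Δ * √((μ {ω | t < f ω}).toReal) := by
  have h2 := fun j => hprops.2.1 j t ht
  generalize (μ {ω | t < f ω}).toReal = F at *
  have hFpos : 0 < F := hΔ.trans_le hF
  obtain ⟨j, hj1, hj2⟩ := exists_nat_pow_near ((one_le_div hΔ).mpr hF) (one_lt_two)
  rw [le_div_iff₀ hΔ] at hj1
  rw [div_lt_iff₀ hΔ] at hj2
  have hpow : (2 : ℝ) ^ (-(j : ℝ)) = (2 ^ j)⁻¹ := by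
    rw [rpow_neg zero_le_two, rpow_natCast]
  have hcond : Δ ≤ 2 ^ (-(j : ℝ)) * F := by
    rw [hpow, inv_mul_eq_div, le_div_iff₀ (by positivity)]
    linarith
  have hle := empP_le_of_abs_sub_le hFpos (h2 j hcond)
  have hsq : ((2 : ℝ) ^ (-(j : ℝ) / 2)) ^ 2 * 2 ^ j = 1 := by
    rw [← rpow_natCast, ← rpow_mul zero_le_two]
    simp only [Nat.cast_ofNat, div_mul_cancel_of_invertible]
    rw [hpow, inv_mul_cancel₀ (by positivity)]
  set s := (2 : ℝ) ^ (-(j : ℝ) / 2)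
  have hsF : F * s ≤ 2 * √Δ * √F := by
    refine abs_le_of_sq_le_sq' ?_ (by positivity) |>.2
    rw [mul_pow, mul_pow, mul_pow, sq_sqrt hΔ.le, sq_sqrt hFpos.le]
    have h3 : F * s ^ 2 ≤ 2 * Δ := by
      calc F * s ^ 2 ≤ 2 ^ (j + 1) * Δ * s ^ 2 := by gcongr
        _ = 2 * Δ * (s ^ 2 * 2 ^ j) := by ring
        _ = 2 * Δ := by rw [hsq, mul_one]
    nlinarith
  linarith

lemma trimmedMean_le_sum_min {N : ℕ} {z : Fin N → ℝ} (hz : ∀ i, 0 ≤ z i) {θ M : ℝ} (hM : 0 ≤ M)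
    (hcard : (Finset.univ.filter fun i => M < z i).card ≤ Nat.ceil (θ * N)) :
    trimmedMean z θ ≤ (N : ℝ)⁻¹ * ∑ i, min (z i) M := by
  refine mul_le_mul_of_nonneg_left ?_ (by positivity)
  rw [← Equiv.sum_comp (Tuple.sort z) fun i => min (z i) M]
  calc _ ≤ ∑ j ∈ Finset.univ.filter (fun j : Fin N => (j : ℕ) < N - Nat.ceil (θ * N)),
        min (z (Tuple.sort z j)) M := by
        refine Finset.sum_le_sum fun j hj => le_min le_rfl ?_
        by_contra! hlt
        have hsub : (Finset.Ici j).map (Tuple.sort z).toEmbedding ⊆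
            Finset.univ.filter fun i => M < z i := by
          intro i hi
          simp only [Finset.mem_map, Finset.mem_Ici] at hi
          obtain ⟨k, hk, rfl⟩ := hi
          simpa using hlt.trans_le (Tuple.monotone_sort z hk)
        have h1 := Finset.card_le_card hsub
        rw [Finset.card_map, Fin.card_Ici] at h1
        have h2 := (Finset.mem_filter.mp hj).2
        omega
    _ ≤ _ := Finset.sum_le_sum_of_subset_of_nonneg (Finset.filter_subset _ _)
        fun j _ _ => le_min (hz _) hM

lemma intervalIntegrable_mul_rpow_mul {p : ℝ} (hp : 1 ≤ p) {g : ℝ → ℝ} (hg : Antitone g)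
    (a b : ℝ) : IntervalIntegrable (fun t => p * t ^ (p - 1) * g t) volume a b := by
  refine (hg.intervalIntegrable).continuousOn_mul (Continuous.continuousOn ?_)
  exact continuous_const.mul (continuous_id.rpow_const fun _ => Or.inr (by linarith))

lemma antitone_ite_lt (a : ℝ) : Antitone fun t : ℝ => if t < a then (1 : ℝ) else 0 := by
  intro s t hst
  dsimp only
  split_ifs <;> linarith

lemma min_rpow_le_integral {p a T : ℝ} (hp : 1 ≤ p) (ha : 0 ≤ a) (hT : 0 ≤ T) :
    min (a ^ p) (T ^ p) ≤
      ∫ t in (0 : ℝ)..T, p * t ^ (p - 1) * (if t < a then (1 : ℝ) else 0) := by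
  have hint := intervalIntegrable_mul_rpow_mul hp (antitone_ite_lt a)
  have hmin : min (a ^ p) (T ^ p) = (min a T) ^ p := by
    rcases le_total a T with h | h
    · rw [min_eq_left h, min_eq_left (rpow_le_rpow ha h (by linarith))]
    · rw [min_eq_right h, min_eq_right (rpow_le_rpow hT h (by linarith))]
  have hm : 0 ≤ min a T := le_min ha hT
  have hfirst : ∫ t in (0 : ℝ)..min a T, p * t ^ (p - 1) * (if t < a then (1 : ℝ) else 0) =
      (min a T) ^ p := by
    have hcongr : ∫ t in (0 : ℝ)..min a T, p * t ^ (p - 1) * (if t < a then (1 : ℝ) else 0) =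
        ∫ t in (0 : ℝ)..min a T, p * t ^ (p - 1) := by
      refine intervalIntegral.integral_congr_ae ?_
      have hne : ∀ᵐ t : ℝ, t ≠ a := by simp [ae_iff]
      filter_upwards [hne] with t hta ht
      rw [Set.uIoc_of_le hm] at ht
      have : t < a := lt_of_le_of_ne (ht.2.trans (min_le_left _ _)) hta
      simp [this]
    rw [hcongr, intervalIntegral.integral_const_mul, integral_rpow (Or.inl (by linarith))]
    have hp0 : p ≠ 0 := by linarith
    simp [hp0, zero_rpow]
    field_simp
  rw [← intervalIntegral.integral_add_adjacent_intervals (hint 0 (min a T)) (hint (min a T) T),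
    hfirst, hmin]
  refine le_add_of_nonneg_right
    (intervalIntegral.integral_nonneg (min_le_right _ _) fun t ht => ?_)
  have : 0 ≤ t := hm.trans ht.1
  have hp0 : 0 ≤ p := by linarith
  split_ifs <;> positivity

lemma integral_tail_le [IsProbabilityMeasure μ] {p T : ℝ} (hp : 1 ≤ p) (hT : 0 ≤ T)
    (hmeas : Measurable f) (hnonneg : ∀ ω, 0 ≤ f ω) (hint : Integrable (fun ω => f ω ^ p) μ) :
    ∫ t in (0 : ℝ)..T, p * t ^ (p - 1) * (μ {ω | t < f ω}).toReal ≤ ∫ ω, f ω ^ p ∂μ := by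
  have hp0 : 0 < p := by linarith
  have hII := intervalIntegrable_mul_rpow_mul hp (antitone_tail (μ := μ) (f := f)) 0 T
  rw [intervalIntegrable_iff_integrableOn_Ioc_of_le hT] at hII
  rw [intervalIntegral.integral_of_le hT]
  have hnn : 0 ≤ᵐ[μ] fun ω => f ω ^ p :=
    Filter.Eventually.of_forall fun ω => rpow_nonneg (hnonneg ω) _
  have hnn2 : 0 ≤ᵐ[volume.restrict (Set.Ioc 0 T)]
      fun t => p * t ^ (p - 1) * (μ {ω | t < f ω}).toReal := by
    filter_upwards [ae_restrict_mem measurableSet_Ioc] with t ht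
    have := ht.1
    simp only [Pi.zero_apply]
    positivity
  rw [← ENNReal.ofReal_le_ofReal_iff (integral_nonneg_of_ae hnn),
    ofReal_integral_eq_lintegral_ofReal hint hnn,
    ofReal_integral_eq_lintegral_ofReal hII hnn2,
    lintegral_rpow_eq_lintegral_meas_lt_mul μ (Filter.Eventually.of_forall hnonneg)
      hmeas.aemeasurable hp0, ← lintegral_const_mul' _ _ ENNReal.ofReal_ne_top]
  refine le_trans (lintegral_mono_ae ?_)
    (lintegral_mono_set fun t (ht : t ∈ Set.Ioc 0 T) => ht.1)
  filter_upwards [ae_restrict_mem measurableSet_Ioc] with t ht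
  have := ht.1
  rw [ENNReal.ofReal_mul (by positivity), ENNReal.ofReal_mul hp0.le,
    ENNReal.ofReal_toReal (measure_ne_top _ _), mul_assoc, mul_comm (ENNReal.ofReal (t ^ _))]

end TrimmedMean

theorem trimmed_mean_upper_bound_general
    (Ω : Type) [MeasurableSpace Ω] (μ : Measure Ω) [IsProbabilityMeasure μ]
    (p : ℝ) (hp : 1 ≤ p)
    (f : Ω → ℝ) (hmeas : Measurable f) (hnonneg : ∀ ω, 0 ≤ f ω)
    (hint : Integrable (fun ω => f ω ^ p) μ)
    (hatomless : ∀ t : ℝ, μ {ω | f ω = t} = 0)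
    (lam C Δ : ℝ) (hlam0 : 0 ≤ lam) (hlam1 : lam < 1) (hC : 1 ≤ C)
    (hΔ0 : 0 < Δ) (hΔ1 : Δ < 1)
    (N : ℕ) (x : Fin N → Ω) (hprops : SatisfiesProps μ f x lam C Δ)
    (θ : ℝ) (hθlow : 4 * Δ * max (1 + lam) (C + 3 / 2) ≤ θ) (hθhigh : θ < 1) :
    trimmedMean (fun i => f (x i) ^ p) θ ≤
      (∫ ω, f ω ^ p ∂μ) + errE μ f Δ p (quant μ f ((θ - 2 * C * Δ) / (1 + lam))) := by
  have hlam : 0 < 1 + lam := by linarith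
  have hθ1 : 4 * Δ * (1 + lam) ≤ θ :=
    (mul_le_mul_of_nonneg_left (le_max_left _ _) (by positivity)).trans hθlow
  have hθ2 : 4 * Δ * (C + 3 / 2) ≤ θ :=
    (mul_le_mul_of_nonneg_left (le_max_right _ _) (by positivity)).trans hθlow
  have hCΔ : 0 < C * Δ := by positivity
  set η := (θ - 2 * C * Δ) / (1 + lam) with hη
  have hηmul : η * (1 + lam) = θ - 2 * C * Δ := div_mul_cancel₀ _ hlam.ne'
  have hΔη : Δ ≤ η := by
    rw [hη, le_div_iff₀ hlam]
    nlinarith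
  have hη0 : 0 < η := hΔ0.trans_le hΔη
  have hη1 : η < 1 := by
    rw [hη, div_lt_one hlam]
    linarith
  obtain ⟨hT0, hFT⟩ := tail_quant hmeas hnonneg hatomless hη0 hη1
  set T := quant μ f η
  have hempT : empP x {ω | T < f ω} ≤ θ := by
    have h := empP_le_of_abs_sub_le (hFT ▸ hη0) (hprops.1 T hT0 (hFT ▸ hΔη))
    rw [hFT, hηmul] at h
    linarith
  have hcard : (Finset.univ.filter fun i => T ^ p < f (x i) ^ p).card ≤ Nat.ceil (θ * N) := by
    rcases Nat.eq_zero_or_pos N with rfl | hN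
    · simp
    have hset : (Finset.univ.filter fun i => T ^ p < f (x i) ^ p) =
        Finset.univ.filter fun i => T < f (x i) := by
      ext i
      simp [rpow_lt_rpow_iff hT0.le (hnonneg (x i)) (by linarith : 0 < p)]
    have hN' : (0 : ℝ) < N := by exact_mod_cast hN
    rw [empP_eq_card, inv_mul_eq_div, div_le_iff₀ hN'] at hempT
    rw [hset]
    exact_mod_cast hempT.trans (Nat.le_ceil _)
  have hIF := intervalIntegrable_mul_rpow_mul hp (antitone_tail (μ := μ) (f := f)) 0 T
  have hIS := intervalIntegrable_mul_rpow_mul hp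
    (fun s t hst => sqrt_le_sqrt (antitone_tail (μ := μ) (f := f) hst) :
      Antitone fun t : ℝ => √(μ {ω | t < f ω}).toReal) 0 T
  have hIE : ∀ i, IntervalIntegrable
      (fun t => p * t ^ (p - 1) * (if t < f (x i) then (1 : ℝ) else 0)) volume 0 T :=
    fun i => intervalIntegrable_mul_rpow_mul hp (antitone_ite_lt (f (x i))) 0 T
  have hemp : ∀ t, (N : ℝ)⁻¹ * ∑ i, p * t ^ (p - 1) * (if t < f (x i) then (1 : ℝ) else 0) =
      p * t ^ (p - 1) * empP x {ω | t < f ω} := by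
    intro t
    simp only [empP, Set.indicator_apply, Set.mem_ofPred_eq]
    rw [← Finset.mul_sum]
    ring
  calc trimmedMean (fun i => f (x i) ^ p) θ
      ≤ (N : ℝ)⁻¹ * ∑ i, min (f (x i) ^ p) (T ^ p) :=
        trimmedMean_le_sum_min (fun i => rpow_nonneg (hnonneg _) _) (rpow_nonneg hT0.le _) hcard
    _ ≤ (N : ℝ)⁻¹ * ∑ i, ∫ t in (0 : ℝ)..T,
          p * t ^ (p - 1) * (if t < f (x i) then (1 : ℝ) else 0) := by
        gcongr with i
        exact min_rpow_le_integral hp (hnonneg _) hT0.le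
    _ = ∫ t in (0 : ℝ)..T, (N : ℝ)⁻¹ * ∑ i,
          p * t ^ (p - 1) * (if t < f (x i) then (1 : ℝ) else 0) := by
        rw [intervalIntegral.integral_const_mul,
          intervalIntegral.integral_finsetSum fun i _ => hIE i]
    _ ≤ ∫ t in (0 : ℝ)..T, (p * t ^ (p - 1) * (μ {ω | t < f ω}).toReal +
          2 * √Δ * (p * t ^ (p - 1) * √((μ {ω | t < f ω}).toReal))) := by
        refine intervalIntegral.integral_mono_on_of_le_Ioo hT0.le ?_
          (hIF.add (hIS.const_mul _)) fun t ht => ?_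
        · simpa only [Finset.sum_fn] using
            (IntervalIntegrable.sum Finset.univ fun i _ => hIE i).const_mul (N : ℝ)⁻¹
        · rw [hemp]
          have htpos : 0 < t := ht.1
          have hle := hprops.empP_le hΔ0 htpos
            (hΔη.trans (le_tail_of_lt_quant hnonneg hη1 ht.2))
          have hw : 0 ≤ p * t ^ (p - 1) := by positivity
          linarith [mul_le_mul_of_nonneg_left hle hw]
    _ = (∫ t in (0 : ℝ)..T, p * t ^ (p - 1) * (μ {ω | t < f ω}).toReal) + errE μ f Δ p T := by
        rw [intervalIntegral.integral_add hIF (hIS.const_mul _),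
          intervalIntegral.integral_const_mul, errE]
    _ ≤ (∫ ω, f ω ^ p ∂μ) + errE μ f Δ p T := by
        gcongr
        exact integral_tail_le hp hT0.le hmeas hnonneg hint
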